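/- Let G be a strongly connected, structurally unbalanced signed digraph, and let L̂ = (W·L + Lᵀ·W)/2 be its mirror Laplacian with eigenvalues λ_1(L̂) ≤ λ_2(L̂) ≤ … ≤ λ_n(L̂) in increasing order (so that λ_1(L̂) > 0). Let k₁ > 0, k₂ > 0 and let m, r, p, q be positive odd integers with m > r and q > p. Suppose x : [0,∞) → ℝⁿ is differentiable and satisfies, for all t ≥ 0 and all i, ẋ_i(t) = k₁·⟨−(L̂·x(t))_i⟩^{m/r} + k₂·⟨−(L̂·x(t))_i⟩^{p/q}, where for y ∈ ℝ and a ratio s of odd integers, ⟨y⟩^{s} := sgn(y)·|y|^{s}. Set T = (1/λ_1(L̂))·( n^{(m−r)/(2r)}·r/(k₁·(m−r)) + q/(k₂·(q−p)) ). Then x(t) = 0 for all t ≥ T (fixed-time state stability with setting time at most T). -/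

import Mathlib

open Matrix BigOperators Filter

/-- In-degree of node `i`: sum of absolute values of the `i`-th row of `A`. -/
noncomputable def inDeg {n : ℕ} (A : Matrix (Fin n) (Fin n) ℝ) (i : Fin n) : ℝ := ∑ j, |A i j|

/-- Laplacian `L = Δ − A` of the signed digraph with adjacency matrix `A`. -/
noncomputable def lapOf {n : ℕ} (A : Matrix (Fin n) (Fin n) ℝ) : Matrix (Fin n) (Fin n) ℝ :=
  Matrix.diagonal (inDeg A) - A

/-- Laplacian `L̄ = Δ − Ā` of the induced unsigned digraph. -/
noncomputable def lapBar {n : ℕ} (A : Matrix (Fin n) (Fin n) ℝ) : Matrix (Fin n) (Fin n) ℝ :=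
  Matrix.diagonal (inDeg A) - Matrix.of (fun i j => |A i j|)

/-- `det(L̄_ii)`: determinant of `L̄` with its `i`-th row and column removed. -/
noncomputable def minorDet {n : ℕ} (A : Matrix (Fin n) (Fin n) ℝ) (i : Fin n) : ℝ :=
  Matrix.det ((lapBar A).submatrix (fun k : {j : Fin n // j ≠ i} => (k : Fin n))
    (fun k : {j : Fin n // j ≠ i} => (k : Fin n)))

/-- `W = diag(det(L̄_11), …, det(L̄_nn))`. -/
noncomputable def Wmat {n : ℕ} (A : Matrix (Fin n) (Fin n) ℝ) : Matrix (Fin n) (Fin n) ℝ :=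
  Matrix.diagonal (minorDet A)

/-- Mirror adjacency matrix `Â = (W·A + Aᵀ·W)/2`. -/
noncomputable def mirrorAdj {n : ℕ} (A : Matrix (Fin n) (Fin n) ℝ) : Matrix (Fin n) (Fin n) ℝ :=
  (1/2 : ℝ) • (Wmat A * A + Aᵀ * Wmat A)

/-- Mirror Laplacian `L̂ = (W·L + Lᵀ·W)/2`. -/
noncomputable def mirrorLap {n : ℕ} (A : Matrix (Fin n) (Fin n) ℝ) : Matrix (Fin n) (Fin n) ℝ :=
  (1/2 : ℝ) • (Wmat A * lapOf A + (lapOf A)ᵀ * Wmat A)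

/-- `(j, i)` is a directed edge when `a_ij ≠ 0`; strong connectivity: a directed
path between every ordered pair of distinct nodes. -/
def StronglyConnected {n : ℕ} (A : Matrix (Fin n) (Fin n) ℝ) : Prop :=
  ∀ i j : Fin n, i ≠ j → Relation.TransGen (fun u v => A v u ≠ 0) i j

/-- `σ` is the diagonal of a gauge transformation: each entry is `±1`. -/
def IsGauge {n : ℕ} (σ : Fin n → ℝ) : Prop := ∀ i, σ i = 1 ∨ σ i = -1

/-- Structural balance: there is a gauge transformation `D = diag σ` with all entries
of `D·A·D` (entrywise `σ i * A i j * σ j`) nonnegative. -/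
def StructBalanced {n : ℕ} (A : Matrix (Fin n) (Fin n) ℝ) : Prop :=
  ∃ σ : Fin n → ℝ, IsGauge σ ∧ ∀ i j, 0 ≤ σ i * A i j * σ j

/-- Improved Laplacian potential function
`Φ_e(x) = Σ_i Σ_j det(L̄_ii)·|a_ij|·(x_i − sgn(a_ij)·x_j)²`. -/
noncomputable def PhiE {n : ℕ} (A : Matrix (Fin n) (Fin n) ℝ) (x : Fin n → ℝ) : ℝ :=
  ∑ i, ∑ j, minorDet A i * |A i j| * (x i - Real.sign (A i j) * x j) ^ 2

/-- A real matrix whose diagonal weakly dominates its rows has nonnegative determinant. -/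
theorem det_nonneg_of_sum_row_le_diag {ι : Type*} [Fintype ι] [DecidableEq ι] (M : Matrix ι ι ℝ)
    (hM : ∀ k, ∑ j ∈ Finset.univ.erase k, |M k j| ≤ M k k) : 0 ≤ M.det := by
  by_contra! hneg
  let f : ℝ → ℝ := fun s => (s • M + (1 - s) • (1 : Matrix ι ι ℝ)).det
  have hf : Continuous f := by fun_prop
  have h0 : f 0 = 1 := by simp [f]
  have h1 : f 1 = M.det := by simp [f]
  obtain ⟨s, ⟨hs0, hs1⟩, hs⟩ : (0 : ℝ) ∈ f '' Set.Icc 0 1 :=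
    intermediate_value_Icc' zero_le_one hf.continuousOn ⟨by rw [h1]; exact hneg.le, by simp [h0]⟩
  have hs1' : s < 1 := hs1.lt_of_ne (by rintro rfl; linarith)
  refine det_ne_zero_of_sum_row_lt_diag (fun k => ?_) hs
  have hsum : ∑ j ∈ Finset.univ.erase k, ‖(s • M + (1 - s) • (1 : Matrix ι ι ℝ)) k j‖
      = s * ∑ j ∈ Finset.univ.erase k, |M k j| := by
    rw [Finset.mul_sum]
    refine Finset.sum_congr rfl fun j hj => ?_
    have hjk : k ≠ j := (Finset.ne_of_mem_erase hj).symm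
    simp [Matrix.one_apply_ne hjk, abs_of_nonneg hs0]
  have hdiag : (s • M + (1 - s) • (1 : Matrix ι ι ℝ)) k k = s * M k k + (1 - s) := by simp
  rw [hsum, hdiag, Real.norm_eq_abs]
  exact (by nlinarith [mul_le_mul_of_nonneg_left (hM k) hs0] :
    _ < s * M k k + (1 - s)).trans_le (le_abs_self _)

theorem lapBar_mulVec {n : ℕ} (A : Matrix (Fin n) (Fin n) ℝ) (u : Fin n → ℝ) (k : Fin n) :
    (lapBar A *ᵥ u) k = inDeg A k * u k - ∑ j, |A k j| * u j := by
  rw [lapBar, Matrix.sub_mulVec, Pi.sub_apply, Matrix.mulVec_diagonal]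
  rfl

theorem lapBar_mulVec_const {n : ℕ} (A : Matrix (Fin n) (Fin n) ℝ) (c : ℝ) :
    lapBar A *ᵥ (fun _ => c) = 0 := by
  ext k
  simp [lapBar_mulVec, inDeg, Finset.sum_mul]

/-- Maximum principle: a vector vanishing at `i` and harmonic away from `i` is zero. -/
theorem eq_zero_of_lapBar_mulVec_eq_zero {n : ℕ} {A : Matrix (Fin n) (Fin n) ℝ}
    (hsc : StronglyConnected A) {i : Fin n} {u : Fin n → ℝ} (hui : u i = 0)
    (hu : ∀ k, k ≠ i → (lapBar A *ᵥ u) k = 0) : u = 0 := by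
  obtain ⟨k, -, hk⟩ := Finset.exists_max_image Finset.univ (fun j => |u j|) ⟨i, Finset.mem_univ i⟩
  replace hk : ∀ j, |u j| ≤ |u k| := fun j => hk j (Finset.mem_univ j)
  have step : ∀ v j, |u v| = |u k| → v ≠ i → A v j ≠ 0 → |u j| = |u k| := by
    intro v j hv hvi hj
    have h := hu v hvi
    rw [lapBar_mulVec, sub_eq_zero, inDeg, Finset.sum_mul] at h
    by_contra hne
    have hlt : ∑ l, |A v l| * |u l| < ∑ l, |A v l| * |u k| :=
      Finset.sum_lt_sum (fun l _ => mul_le_mul_of_nonneg_left (hk l) (abs_nonneg _))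
        ⟨j, Finset.mem_univ j,
          mul_lt_mul_of_pos_left ((hk j).lt_of_ne hne) (abs_pos.mpr hj)⟩
    have hle : |∑ l, |A v l| * u l| ≤ ∑ l, |A v l| * |u l| := by
      refine (Finset.abs_sum_le_sum_abs _ _).trans_eq ?_
      simp [abs_mul]
    rw [← h, ← Finset.sum_mul, abs_mul, hv,
      abs_of_nonneg (Finset.sum_nonneg fun l _ => abs_nonneg _), Finset.sum_mul] at hle
    exact hle.not_gt hlt
  have hik : |u k| = 0 := by
    by_cases hki : k = i
    · simp [hki, hui]
    · have key : ∀ a, Relation.TransGen (fun v w => A w v ≠ 0) a k →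
          |u a| = |u k| ∨ |u i| = |u k| := by
        intro a ha
        induction ha using Relation.TransGen.head_induction_on with
        | single h => exact Or.inl (step _ _ rfl hki h)
        | @head a c hac _ ih =>
          rcases ih with ih | ih
          · by_cases hci : c = i
            · exact Or.inr (hci ▸ ih)
            · exact Or.inl (step _ _ ih hci hac)
          · exact Or.inr ih
      have := key i (hsc i k (Ne.symm hki))
      rw [or_self, hui, abs_zero] at this
      exact this.symm
  ext j
  exact abs_eq_zero.mp (le_antisymm ((hk j).trans_eq hik) (abs_nonneg _))

theorem minorDet_ne_zero {n : ℕ} {A : Matrix (Fin n) (Fin n) ℝ} (hsc : StronglyConnected A)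
    (i : Fin n) : minorDet A i ≠ 0 := by
  intro h
  obtain ⟨v, hv, hMv⟩ := Matrix.exists_mulVec_eq_zero_iff.mpr h
  let u : Fin n → ℝ := fun j => if hj : j ≠ i then v ⟨j, hj⟩ else 0
  have hu : u = 0 := by
    refine eq_zero_of_lapBar_mulVec_eq_zero hsc (i := i) (by simp [u]) fun k hk => ?_
    have hsplit := congrFun hMv ⟨k, hk⟩
    simp only [Matrix.mulVec, dotProduct, Matrix.submatrix_apply, Pi.zero_apply] at hsplit ⊢
    rw [← hsplit, ← Fintype.sum_subtype_add_sum_subtype (fun j => j ≠ i),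
      Finset.sum_eq_zero (s := Finset.univ (α := {j // ¬ j ≠ i})) fun j _ => by simp [u, j.2],
      add_zero]
    exact Finset.sum_congr rfl fun j _ => by simp [u, j.2]
  refine hv (funext fun j => ?_)
  have := congrFun hu j
  simpa [u, j.2] using this

theorem minorDet_pos {n : ℕ} {A : Matrix (Fin n) (Fin n) ℝ} (hdiag : ∀ i, A i i = 0)
    (hsc : StronglyConnected A) (i : Fin n) : 0 < minorDet A i := by
  refine lt_of_le_of_ne (det_nonneg_of_sum_row_le_diag _ fun k => ?_) (minorDet_ne_zero hsc i).symm
  have hoff : ∀ j ∈ Finset.univ.erase k,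
      |(lapBar A).submatrix (fun k : {j : Fin n // j ≠ i} => (k : Fin n))
        (fun k : {j : Fin n // j ≠ i} => (k : Fin n)) k j| = |A k j| := by
    intro j hj
    have hkj : (k : Fin n) ≠ j := fun h => Finset.ne_of_mem_erase hj (Subtype.ext h.symm)
    simp [lapBar, Matrix.diagonal_apply_ne _ hkj]
  rw [Finset.sum_congr rfl hoff]
  have hkk : (lapBar A).submatrix (fun k : {j : Fin n // j ≠ i} => (k : Fin n))
      (fun k : {j : Fin n // j ≠ i} => (k : Fin n)) k k = inDeg A k := by
    simp [lapBar, hdiag]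
  rw [hkk, inDeg]
  calc ∑ j ∈ Finset.univ.erase k, |A k j| ≤ ∑ j : {j : Fin n // j ≠ i}, |A k j| :=
        Finset.sum_le_sum_of_subset_of_nonneg (Finset.erase_subset _ _) fun _ _ _ => abs_nonneg _
    _ = ∑ j ∈ Finset.univ.filter (· ≠ i), |A k j| := by
        rw [Finset.sum_subtype (p := fun j => j ≠ i)]; simp
    _ ≤ ∑ j, |A k j| :=
        Finset.sum_le_sum_of_subset_of_nonneg (Finset.filter_subset _ _) fun _ _ _ => abs_nonneg _

theorem adjugate_lapBar_diag {n : ℕ} (A : Matrix (Fin n) (Fin n) ℝ) (i : Fin n) :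
    (lapBar A).adjugate i i = minorDet A i := by
  cases n with
  | zero => exact i.elim0
  | succ n =>
    rw [Matrix.adjugate_fin_succ_eq_det_submatrix, minorDet,
      ← Matrix.det_submatrix_equiv_self (finSuccAboveEquiv i)]
    rw [Even.neg_one_pow ⟨_, rfl⟩, one_mul]
    rfl

theorem det_lapBar {n : ℕ} (A : Matrix (Fin n) (Fin n) ℝ) (i : Fin n) : (lapBar A).det = 0 := by
  refine Matrix.exists_mulVec_eq_zero_iff.mp ⟨fun _ => 1, fun h => ?_, lapBar_mulVec_const A 1⟩
  simpa using congrFun h i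

theorem adjugate_lapBar {n : ℕ} {A : Matrix (Fin n) (Fin n) ℝ} (hsc : StronglyConnected A)
    (i j : Fin n) : (lapBar A).adjugate i j = minorDet A j := by
  have hcol : lapBar A *ᵥ (fun k => (lapBar A).adjugate k j) = 0 := by
    ext k
    have := congrFun (congrFun (Matrix.mul_adjugate (lapBar A)) k) j
    simpa [det_lapBar A i, Matrix.mul_apply, Matrix.mulVec, dotProduct] using this
  have h0 := eq_zero_of_lapBar_mulVec_eq_zero hsc (i := j)
    (u := (fun k => (lapBar A).adjugate k j) - fun _ => minorDet A j)
    (by simp [adjugate_lapBar_diag])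
    (fun k _ => by rw [Matrix.mulVec_sub, hcol, lapBar_mulVec_const]; simp)
  exact sub_eq_zero.mp (congrFun h0 i)

/-- The vector of principal cofactors of `L̄` is a left null vector of `L̄`. -/
theorem sum_minorDet_mul_abs {n : ℕ} {A : Matrix (Fin n) (Fin n) ℝ} (hsc : StronglyConnected A)
    (j : Fin n) : ∑ i, minorDet A i * |A i j| = minorDet A j * inDeg A j := by
  have h := congrFun (congrFun (Matrix.adjugate_mul (lapBar A)) j) j
  simp only [det_lapBar A j, Matrix.mul_apply, adjugate_lapBar hsc, zero_smul,
    Matrix.zero_apply] at h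
  simp only [lapBar, Matrix.sub_apply, Matrix.of_apply, mul_sub, Finset.sum_sub_distrib,
    Matrix.diagonal_apply, mul_ite, mul_zero, Finset.sum_ite_eq', Finset.mem_univ, if_true] at h
  linarith

theorem dotProduct_mirrorLap_mulVec {n : ℕ} {A : Matrix (Fin n) (Fin n) ℝ}
    (hsc : StronglyConnected A) (x : Fin n → ℝ) :
    x ⬝ᵥ (mirrorLap A *ᵥ x) = PhiE A x / 2 := by
  have hsym : x ⬝ᵥ (mirrorLap A *ᵥ x) = x ⬝ᵥ ((Wmat A * lapOf A) *ᵥ x) := by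
    have ht : (lapOf A)ᵀ * Wmat A = (Wmat A * lapOf A)ᵀ := by
      rw [Matrix.transpose_mul, Wmat, Matrix.diagonal_transpose]
    rw [mirrorLap, ht, Matrix.smul_mulVec, Matrix.add_mulVec, dotProduct_smul, dotProduct_add,
      Matrix.mulVec_transpose, dotProduct_comm x (x ᵥ* _), ← Matrix.dotProduct_mulVec, smul_eq_mul]
    ring
  have hterm : ∀ i j, minorDet A i * |A i j| * (x i - Real.sign (A i j) * x j) ^ 2
      = minorDet A i * |A i j| * x i ^ 2 - 2 * (minorDet A i * x i * (A i j * x j))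
        + minorDet A i * |A i j| * x j ^ 2 := by
    intro i j
    rcases lt_trichotomy (A i j) 0 with h | h | h
    · rw [Real.sign_of_neg h, abs_of_neg h]; ring
    · simp [h]
    · rw [Real.sign_of_pos h, abs_of_pos h]; ring
  have h1 : ∑ i, ∑ j, minorDet A i * |A i j| * x i ^ 2 =
      ∑ i, minorDet A i * inDeg A i * x i ^ 2 := by
    simp only [inDeg, Finset.mul_sum, Finset.sum_mul]
  have h2 : ∑ i, ∑ j, minorDet A i * |A i j| * x j ^ 2 =
      ∑ i, minorDet A i * inDeg A i * x i ^ 2 := by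
    rw [Finset.sum_comm]
    simp only [← Finset.sum_mul, sum_minorDet_mul_abs hsc]
  have h3 : x ⬝ᵥ ((Wmat A * lapOf A) *ᵥ x) = ∑ i, minorDet A i * inDeg A i * x i ^ 2
      - ∑ i, ∑ j, minorDet A i * x i * (A i j * x j) := by
    rw [← Matrix.mulVec_mulVec, Wmat, lapOf, dotProduct, ← Finset.sum_sub_distrib]
    refine Finset.sum_congr rfl fun i _ => ?_
    rw [Matrix.mulVec_diagonal, Matrix.sub_mulVec, Pi.sub_apply, Matrix.mulVec_diagonal,
      ← Finset.mul_sum]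
    simp only [Matrix.mulVec, dotProduct]
    ring
  simp only [hsym, h3, PhiE, hterm, Finset.sum_add_distrib, Finset.sum_sub_distrib, h1, h2,
    ← Finset.mul_sum]
  ring

theorem mirrorLap_posDef {n : ℕ} {A : Matrix (Fin n) (Fin n) ℝ} (hdiag : ∀ i, A i i = 0)
    (hsc : StronglyConnected A) (hunbal : ¬ StructBalanced A) (hH : (mirrorLap A).IsHermitian) :
    (mirrorLap A).PosDef := by
  refine Matrix.PosDef.of_dotProduct_mulVec_pos hH fun x hx => ?_
  rw [star_trivial, dotProduct_mirrorLap_mulVec hsc]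
  have hnn : ∀ i j, 0 ≤ minorDet A i * |A i j| * (x i - Real.sign (A i j) * x j) ^ 2 := fun i j =>
    mul_nonneg (mul_nonneg (minorDet_pos hdiag hsc i).le (abs_nonneg _)) (sq_nonneg _)
  have hnn' : 0 ≤ PhiE A x := Finset.sum_nonneg fun i _ => Finset.sum_nonneg fun j _ => hnn i j
  refine half_pos (hnn'.lt_of_ne fun h0 => hunbal ?_)
  have hedge : ∀ i j, A i j ≠ 0 → x i = Real.sign (A i j) * x j := by
    intro i j hij
    have hi := (Finset.sum_eq_zero_iff_of_nonneg
      fun i _ => Finset.sum_nonneg fun j _ => hnn i j).mp h0.symm i (Finset.mem_univ i)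
    have hj := (Finset.sum_eq_zero_iff_of_nonneg fun j _ => hnn i j).mp hi j (Finset.mem_univ j)
    have hne : minorDet A i * |A i j| ≠ 0 :=
      mul_ne_zero (minorDet_pos hdiag hsc i).ne' (abs_ne_zero.mpr hij)
    exact sub_eq_zero.mp (pow_eq_zero_iff two_ne_zero |>.mp ((mul_eq_zero.mp hj).resolve_left hne))
  have hzero : ∀ i j, Relation.TransGen (fun u v => A v u ≠ 0) i j → x i = 0 → x j = 0 := by
    intro i j hij hi
    induction hij with
    | single h => rw [hedge _ _ h, hi, mul_zero]
    | tail _ h ih => rw [hedge _ _ h, ih, mul_zero]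
  have hne : ∀ i, x i ≠ 0 := fun i hi => hx <| funext fun j => by
    by_cases hij : i = j
    · exact hij ▸ hi
    · exact hzero i j (hsc i j hij) hi
  refine ⟨fun i => Real.sign (x i), fun i => (Real.sign_apply_eq_of_ne_zero _ (hne i)).symm,
    fun i j => ?_⟩
  beta_reduce
  by_cases hij : A i j = 0
  · simp [hij]
  · have h := hedge i j hij
    rcases lt_or_gt_of_ne hij with hA | hA
    · rw [Real.sign_of_neg hA, neg_one_mul] at h
      rw [h]
      rcases lt_or_gt_of_ne (hne j) with hj | hj
      · rw [Real.sign_of_neg hj, Real.sign_of_pos (by linarith)]; linarith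
      · rw [Real.sign_of_pos hj, Real.sign_of_neg (by linarith)]; linarith
    · rw [Real.sign_of_pos hA, one_mul] at h
      rw [h]
      rcases lt_or_gt_of_ne (hne j) with hj | hj
      · rw [Real.sign_of_neg hj]; linarith
      · rw [Real.sign_of_pos hj]; linarith

theorem mul_dotProduct_self_le {n : ℕ} {H : Matrix (Fin n) (Fin n) ℝ} (hH : H.IsHermitian) {c : ℝ}
    (hc : ∀ i, c ≤ hH.eigenvalues i) (x : Fin n → ℝ) : c * (x ⬝ᵥ x) ≤ x ⬝ᵥ (H *ᵥ x) := by
  have hpsd : (H - c • (1 : Matrix (Fin n) (Fin n) ℝ)).PosSemidef := by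
    have heq : H - c • (1 : Matrix (Fin n) (Fin n) ℝ) =
        Unitary.conjStarAlgAut ℝ _ hH.eigenvectorUnitary
          (Matrix.diagonal fun i => hH.eigenvalues i - c) := by
      have hd : (Matrix.diagonal fun i => hH.eigenvalues i - c) =
          Matrix.diagonal (RCLike.ofReal ∘ hH.eigenvalues) - c • (1 : Matrix (Fin n) (Fin n) ℝ) := by
        ext i j
        by_cases hij : i = j <;> simp [hij]
      rw [hd, map_sub, map_smul, map_one, ← hH.spectral_theorem]
    rw [heq]
    simp [Unitary.isUnit_coe.posSemidef_star_right_conjugate_iff, Matrix.posSemidef_diagonal_iff, hc]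
  have h := hpsd.dotProduct_mulVec_nonneg x
  rw [star_trivial, Matrix.sub_mulVec, Matrix.smul_mulVec, Matrix.one_mulVec, dotProduct_sub,
    dotProduct_smul, smul_eq_mul] at h
  linarith

/-- If the eigenvalues of `H` are at least `c > 0`, then `c H ≤ H²` as quadratic forms. -/
theorem mul_dotProduct_mulVec_le {n : ℕ} {H : Matrix (Fin n) (Fin n) ℝ} (hH : H.IsHermitian) {c : ℝ}
    (hc0 : 0 < c) (hc : ∀ i, c ≤ hH.eigenvalues i) (x : Fin n → ℝ) :
    c * (x ⬝ᵥ (H *ᵥ x)) ≤ (H *ᵥ x) ⬝ᵥ (H *ᵥ x) := by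
  have h1 := mul_dotProduct_self_le hH hc x
  have h2 : 0 ≤ (H *ᵥ x - c • x) ⬝ᵥ (H *ᵥ x - c • x) :=
    Finset.sum_nonneg fun i _ => mul_self_nonneg _
  simp only [sub_dotProduct, dotProduct_sub, smul_dotProduct, dotProduct_smul, smul_eq_mul,
    dotProduct_comm (H *ᵥ x) x] at h2
  nlinarith [mul_le_mul_of_nonneg_left h1 hc0.le]

theorem rpow_sum_le_sum_rpow {ι : Type*} (s : Finset ι) {f : ι → ℝ} (hf : ∀ i ∈ s, 0 ≤ f i) {b : ℝ}
    (hb0 : 0 < b) (hb1 : b ≤ 1) : (∑ i ∈ s, f i) ^ b ≤ ∑ i ∈ s, f i ^ b :=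
  Finset.le_sum_of_subadditive_on_pred (fun y : ℝ => y ^ b) (fun y => 0 ≤ y)
    (Real.zero_rpow hb0.ne').le (fun _ _ hx hy => Real.rpow_add_le_add_rpow hx hy hb0.le hb1)
    (fun _ _ => add_nonneg) f hf

/-- A nonnegative function with `Q' ≤ -(a Q ^ α + b Q ^ β)`, `β < 1 < α`, vanishes after a time
that does not depend on its initial value. -/
theorem eq_zero_of_deriv_le_neg_rpow_add_rpow {Q Q' : ℝ → ℝ} {a b α β : ℝ} (ha : 0 < a) (hb : 0 < b)
    (hα : 1 < α) (hβ : β < 1) (hQ : ∀ t, 0 ≤ t → 0 ≤ Q t)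
    (hderiv : ∀ t, 0 ≤ t → HasDerivWithinAt Q (Q' t) (Set.Ici 0) t)
    (hle : ∀ t, 0 ≤ t → Q' t ≤ -(a * Q t ^ α + b * Q t ^ β)) {t : ℝ}
    (ht : 1 / (a * (α - 1)) + 1 / (b * (1 - β)) ≤ t) : Q t = 0 := by
  have haα : 0 < a * (α - 1) := mul_pos ha (sub_pos.mpr hα)
  have hbβ : 0 < b * (1 - β) := mul_pos hb (sub_pos.mpr hβ)
  set t₁ := 1 / (a * (α - 1)) with ht₁
  have ht₁0 : 0 < t₁ := one_div_pos.mpr haα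
  have ht₂0 : 0 < 1 / (b * (1 - β)) := one_div_pos.mpr hbβ
  have ht₁t : t₁ ≤ t := by linarith
  have ht0 : 0 ≤ t := by linarith
  by_contra hne
  have hanti : AntitoneOn Q (Set.Ici 0) := by
    refine antitoneOn_of_hasDerivWithinAt_nonpos (convex_Ici 0)
      (fun s hs => (hderiv s hs).continuousWithinAt)
      (fun s hs => (hderiv s (interior_subset hs)).mono interior_subset) fun s hs => ?_
    have hs0 := interior_subset (s := Set.Ici (0 : ℝ)) hs
    have h1 := mul_nonneg ha.le (Real.rpow_nonneg (hQ s hs0) α)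
    have h2 := mul_nonneg hb.le (Real.rpow_nonneg (hQ s hs0) β)
    linarith [hle s hs0]
  have hpos : ∀ s ∈ Set.Icc 0 t, 0 < Q s := fun s hs =>
    ((hQ t ht0).lt_of_ne' hne).trans_le (hanti hs.1 ht0 hs.2)
  have hpow : ∀ γ, ∀ s ∈ Set.Icc 0 t, HasDerivWithinAt (fun s => Q s ^ γ)
      (Q' s * γ * Q s ^ (γ - 1)) (Set.Icc 0 t) s := fun γ s hs =>
    ((hderiv s hs.1).mono Set.Icc_subset_Ici_self).rpow_const (Or.inl (hpos s hs).ne')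
  have hmul : ∀ γ δ : ℝ, ∀ s ∈ Set.Icc 0 t, Q s ^ γ * Q s ^ δ = Q s ^ (γ + δ) := fun γ δ s hs =>
    (Real.rpow_add (hpos s hs) γ δ).symm
  have hmono₁ : MonotoneOn (fun s => Q s ^ (1 - α) - a * (α - 1) * s) (Set.Icc 0 t) := by
    have hd : ∀ s ∈ Set.Icc 0 t, HasDerivWithinAt (fun s => Q s ^ (1 - α) - a * (α - 1) * s)
        (Q' s * (1 - α) * Q s ^ (1 - α - 1) - a * (α - 1) * 1) (Set.Icc 0 t) s := fun s hs =>
      (hpow (1 - α) s hs).sub ((hasDerivWithinAt_id s _).const_mul _)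
    refine monotoneOn_of_hasDerivWithinAt_nonneg (convex_Icc 0 t)
      (fun s hs => (hd s hs).continuousWithinAt)
      (fun s hs => (hd s (interior_subset hs)).mono interior_subset) fun s hs => ?_
    replace hs := interior_subset hs
    have hp := Real.rpow_pos_of_pos (hpos s hs) (1 - α - 1)
    have h1 : Q s ^ α * Q s ^ (1 - α - 1) = 1 := by rw [hmul _ _ s hs]; simp
    have h2 := mul_nonneg hb.le (Real.rpow_nonneg (hQ s hs.1) β)
    have h3 : Q' s ≤ -(a * Q s ^ α) := by linarith [hle s hs.1]
    have h4 := mul_le_mul_of_nonneg_right h3 hp.le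
    rw [neg_mul, mul_assoc, h1] at h4
    nlinarith [mul_le_mul_of_nonneg_left h4 (sub_pos.mpr hα).le]
  have hanti₂ : AntitoneOn (fun s => Q s ^ (1 - β) + b * (1 - β) * s) (Set.Icc 0 t) := by
    have hd : ∀ s ∈ Set.Icc 0 t, HasDerivWithinAt (fun s => Q s ^ (1 - β) + b * (1 - β) * s)
        (Q' s * (1 - β) * Q s ^ (1 - β - 1) + b * (1 - β) * 1) (Set.Icc 0 t) s := fun s hs =>
      (hpow (1 - β) s hs).add ((hasDerivWithinAt_id s _).const_mul _)
    refine antitoneOn_of_hasDerivWithinAt_nonpos (convex_Icc 0 t)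
      (fun s hs => (hd s hs).continuousWithinAt)
      (fun s hs => (hd s (interior_subset hs)).mono interior_subset) fun s hs => ?_
    replace hs := interior_subset hs
    have hp := Real.rpow_pos_of_pos (hpos s hs) (1 - β - 1)
    have h1 : Q s ^ β * Q s ^ (1 - β - 1) = 1 := by rw [hmul _ _ s hs]; simp
    have h2 := mul_nonneg ha.le (Real.rpow_nonneg (hQ s hs.1) α)
    have h3 : Q' s ≤ -(b * Q s ^ β) := by linarith [hle s hs.1]
    have h4 := mul_le_mul_of_nonneg_right h3 hp.le
    rw [neg_mul, mul_assoc, h1] at h4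
    nlinarith [mul_le_mul_of_nonneg_left h4 (sub_pos.mpr hβ).le]
  have hm0 : (0 : ℝ) ∈ Set.Icc 0 t := ⟨le_rfl, ht0⟩
  have hm1 : t₁ ∈ Set.Icc 0 t := ⟨ht₁0.le, ht₁t⟩
  have hmt : t ∈ Set.Icc 0 t := ⟨ht0, le_rfl⟩
  have hstage₁ := hmono₁ hm0 hm1 ht₁0.le
  have hstage₂ := hanti₂ hm1 hmt ht₁t
  simp only at hstage₁ hstage₂
  have h1 : a * (α - 1) * t₁ = 1 := mul_one_div_cancel haα.ne'
  have hQ₁ : Q t₁ ≤ 1 := by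
    by_contra! hgt
    have := Real.rpow_lt_one_of_one_lt_of_neg hgt (sub_neg.mpr hα)
    have := Real.rpow_pos_of_pos (hpos 0 hm0) (1 - α)
    linarith
  have h2 := Real.rpow_le_one (hpos t₁ hm1).le hQ₁ (sub_pos.mpr hβ).le
  have h3 := Real.rpow_pos_of_pos (hpos t hmt) (1 - β)
  have h4 : b * (1 - β) * (1 / (b * (1 - β))) = 1 := mul_one_div_cancel hbβ.ne'
  have h5 := mul_le_mul_of_nonneg_left (by linarith : 1 / (b * (1 - β)) ≤ t - t₁) hbβ.le
  linarith

theorem mul_sign_neg_mul_rpow (y : ℝ) {s : ℝ} (hs : 0 < s) :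
    y * (Real.sign (-y) * |(-y)| ^ s) = -(y ^ 2) ^ ((s + 1) / 2) := by
  have hsq : (y ^ 2) ^ ((s + 1) / 2) = |y| * |y| ^ s := by
    rw [← sq_abs, ← Real.rpow_natCast, ← Real.rpow_mul (abs_nonneg y), mul_comm |y|,
      ← Real.rpow_add_one' (abs_nonneg y) (by linarith)]
    congr 1
    push_cast
    ring
  rw [hsq, abs_neg, Real.sign_neg]
  rcases lt_trichotomy y 0 with h | rfl | h
  · rw [Real.sign_of_neg h, abs_of_neg h]; ring
  · simp
  · rw [Real.sign_of_pos h, abs_of_pos h]; ring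

theorem hasDerivWithinAt_dotProduct_mulVec {n : ℕ} {H : Matrix (Fin n) (Fin n) ℝ}
    (hH : H.IsHermitian) {x : ℝ → Fin n → ℝ} {x' : Fin n → ℝ} {S : Set ℝ} {t : ℝ}
    (hx : ∀ i, HasDerivWithinAt (fun s => x s i) (x' i) S t) :
    HasDerivWithinAt (fun s => x s ⬝ᵥ (H *ᵥ x s)) (2 * ((H *ᵥ x t) ⬝ᵥ x')) S t := by
  have hHx : ∀ i, HasDerivWithinAt (fun s => (H *ᵥ x s) i) ((H *ᵥ x') i) S t := fun i =>
    HasDerivWithinAt.fun_sum (u := Finset.univ) fun j _ => (hx j).const_mul (H i j)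
  have h : HasDerivWithinAt (fun s => x s ⬝ᵥ (H *ᵥ x s))
      (∑ i, (x' i * (H *ᵥ x t) i + x t i * (H *ᵥ x') i)) S t :=
    HasDerivWithinAt.fun_sum fun i _ => (hx i).mul (hHx i)
  convert h using 1
  have hsym : x t ⬝ᵥ (H *ᵥ x') = (H *ᵥ x t) ⬝ᵥ x' := by
    have hT : Hᵀ = H := by simpa using hH.eq
    rw [Matrix.dotProduct_mulVec, ← Matrix.mulVec_transpose, hT]
  rw [Finset.sum_add_distrib]
  change _ = x' ⬝ᵥ (H *ᵥ x t) + x t ⬝ᵥ (H *ᵥ x')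
  rw [hsym, dotProduct_comm x']
  ring

/-- fixed-time state stability under the nonlinear protocol, on a
strongly connected structurally unbalanced signed digraph, with setting time at most
`T = (1/λ₁(L̂))·( n^{(m−r)/(2r)}·r/(k₁(m−r)) + q/(k₂(q−p)) )`. -/
theorem fixed_time_state_stability (n : ℕ) (hn : 2 ≤ n)
    (A : Matrix (Fin n) (Fin n) ℝ)
    (hdiag : ∀ i, A i i = 0) (hdigon : ∀ i j, 0 ≤ A i j * A j i)
    (hsc : StronglyConnected A)
    (hunbal : ¬ StructBalanced A)
    (hH : (mirrorLap A).IsHermitian)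
    (lam : Fin n → ℝ) (hlam : ∃ e : Fin n ≃ Fin n, lam = hH.eigenvalues ∘ e)
    (hmono : Monotone lam)
    (k₁ k₂ : ℝ) (hk₁ : 0 < k₁) (hk₂ : 0 < k₂)
    (m r p q : ℕ) (hmodd : Odd m) (hrodd : Odd r) (hpodd : Odd p) (hqodd : Odd q)
    (hm0 : 0 < m) (hr0 : 0 < r) (hp0 : 0 < p) (hq0 : 0 < q)
    (hmr : r < m) (hpq : p < q)
    (x : ℝ → Fin n → ℝ)
    (hx : ∀ t : ℝ, 0 ≤ t → ∀ i : Fin n,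
      HasDerivWithinAt (fun s => x s i)
        (k₁ * (Real.sign (-((mirrorLap A *ᵥ x t) i)) *
            |(-((mirrorLap A *ᵥ x t) i))| ^ ((m : ℝ) / r)) +
         k₂ * (Real.sign (-((mirrorLap A *ᵥ x t) i)) *
            |(-((mirrorLap A *ᵥ x t) i))| ^ ((p : ℝ) / q)))
        (Set.Ici (0 : ℝ)) t)
    (T : ℝ)
    (hT : T = (1 / lam ⟨0, by omega⟩) *
      ((n : ℝ) ^ (((m : ℝ) - r) / (2 * r)) * r / (k₁ * ((m : ℝ) - r)) +
        q / (k₂ * ((q : ℝ) - p)))) :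
    ∀ t : ℝ, T ≤ t → x t = 0 := by
  have hpd := mirrorLap_posDef hdiag hsc hunbal hH
  set l := lam ⟨0, by omega⟩ with hl
  obtain ⟨e, he⟩ := hlam
  have hl0 : 0 < l := by
    rw [hl, he]
    exact hpd.eigenvalues_pos _
  have hlmin : ∀ i, l ≤ hH.eigenvalues i := by
    intro i
    have h : lam (e.symm i) = hH.eigenvalues i := by simp [he]
    rw [← h]
    exact hmono (Fin.mk_le_of_le_val (Nat.zero_le _))
  have hm : (0 : ℝ) < m := Nat.cast_pos.mpr hm0
  have hr : (0 : ℝ) < r := Nat.cast_pos.mpr hr0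
  have hp : (0 : ℝ) < p := Nat.cast_pos.mpr hp0
  have hq : (0 : ℝ) < q := Nat.cast_pos.mpr hq0
  have hmr' : (r : ℝ) < m := Nat.cast_lt.mpr hmr
  have hpq' : (p : ℝ) < q := Nat.cast_lt.mpr hpq
  have hn0 : (0 : ℝ) < n := Nat.cast_pos.mpr (by omega)
  have hs₁ : 1 < (m : ℝ) / r := (one_lt_div hr).mpr hmr'
  have hs₂ : (p : ℝ) / q < 1 := (div_lt_one hq).mpr hpq'
  have hs₂0 : 0 < (p : ℝ) / q := div_pos hp hq
  set α : ℝ := ((m : ℝ) / r + 1) / 2 with hα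
  set β : ℝ := ((p : ℝ) / q + 1) / 2 with hβ
  have hα1 : 1 < α := by linarith
  have hβ1 : β < 1 := by linarith
  have hβ0 : 0 < β := by linarith
  have hnα : 0 < (n : ℝ) ^ (α - 1) := Real.rpow_pos_of_pos hn0 _
  have hnonneg : ∀ y : Fin n → ℝ, 0 ≤ y ⬝ᵥ (mirrorLap A *ᵥ y) := fun y => by
    simpa using hpd.posSemidef.dotProduct_mulVec_nonneg y
  intro t ht
  have hQt : l * (x t ⬝ᵥ (mirrorLap A *ᵥ x t)) = 0 := by
    refine eq_zero_of_deriv_le_neg_rpow_add_rpow (Q := fun s => l * (x s ⬝ᵥ (mirrorLap A *ᵥ x s)))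
      (a := 2 * l * k₁ / (n : ℝ) ^ (α - 1)) (b := 2 * l * k₂) (by positivity) (by positivity)
      hα1 hβ1 (fun s _ => mul_nonneg hl0.le (hnonneg _))
      (fun s hs => (hasDerivWithinAt_dotProduct_mulVec hH (hx s hs)).const_mul l)
      (fun s _ => ?_) ?_
    · set y := mirrorLap A *ᵥ x s with hy
      have hle : l * (x s ⬝ᵥ y) ≤ ∑ i, y i ^ 2 := by
        simpa only [dotProduct, sq] using mul_dotProduct_mulVec_le hH hl0 hlmin (x s)
      have hQ0 : 0 ≤ l * (x s ⬝ᵥ y) := mul_nonneg hl0.le (hnonneg _)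
      have h₁ : (l * (x s ⬝ᵥ y)) ^ α ≤ (n : ℝ) ^ (α - 1) * ∑ i, (y i ^ 2) ^ α := by
        refine (Real.rpow_le_rpow hQ0 hle (by linarith)).trans ?_
        simpa using Real.rpow_sum_le_const_mul_sum_rpow_of_nonneg Finset.univ
          (f := fun i => y i ^ 2) hα1.le fun i _ => sq_nonneg _
      have h₂ : (l * (x s ⬝ᵥ y)) ^ β ≤ ∑ i, (y i ^ 2) ^ β :=
        (Real.rpow_le_rpow hQ0 hle hβ0.le).trans
          (rpow_sum_le_sum_rpow _ (fun i _ => sq_nonneg _) hβ0 hβ1.le)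
      have hsum : (y ⬝ᵥ fun i => k₁ * (Real.sign (-(y i)) * |(-(y i))| ^ ((m : ℝ) / r)) +
          k₂ * (Real.sign (-(y i)) * |(-(y i))| ^ ((p : ℝ) / q))) =
          -(k₁ * ∑ i, (y i ^ 2) ^ α + k₂ * ∑ i, (y i ^ 2) ^ β) := by
        rw [dotProduct, Finset.mul_sum, Finset.mul_sum, ← Finset.sum_add_distrib,
          ← Finset.sum_neg_distrib]
        refine Finset.sum_congr rfl fun i _ => ?_
        rw [mul_add, mul_left_comm (y i) k₁, mul_left_comm (y i) k₂,
          mul_sign_neg_mul_rpow _ (zero_lt_one.trans hs₁), mul_sign_neg_mul_rpow _ hs₂0]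
        ring
      rw [hsum]
      have h₁' : (l * (x s ⬝ᵥ y)) ^ α / (n : ℝ) ^ (α - 1) ≤ ∑ i, (y i ^ 2) ^ α :=
        (div_le_iff₀' hnα).mpr h₁
      have h₃ := mul_le_mul_of_nonneg_left h₁' (by positivity : 0 ≤ 2 * l * k₁)
      have h₄ := mul_le_mul_of_nonneg_left h₂ (by positivity : 0 ≤ 2 * l * k₂)
      rw [div_mul_eq_mul_div, ← mul_div_assoc']
      linarith
    · refine le_trans (le_of_eq ?_) ht
      have hexp : ((m : ℝ) - r) / (2 * r) = α - 1 := by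
        rw [hα]; field_simp; ring
      have hα' : α - 1 = ((m : ℝ) - r) / (2 * r) := hexp.symm
      have hβ' : 1 - β = ((q : ℝ) - p) / (2 * q) := by
        rw [hβ]; field_simp; ring
      rw [hT, hexp]
      generalize (n : ℝ) ^ (α - 1) = N at hnα
      rw [hα', hβ']
      have : (m : ℝ) - r ≠ 0 := by linarith
      have : (q : ℝ) - p ≠ 0 := by linarith
      field_simp
  by_contra hne
  have hpos : 0 < x t ⬝ᵥ (mirrorLap A *ᵥ x t) := by
    simpa using hpd.dotProduct_mulVec_pos hne
  exact (mul_pos hl0 hpos).ne' hQt
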